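/- Let X be a geodesic metric space and let e, f ∈ X. For every Morse gauge N there exists a Morse gauge N', depending only on N and d(e,f), such that X^(N)_e ⊆ X^(N')_f, and the induced injection ∂X^(N)_e → ∂X^(N')_f of sequential boundaries is, for any visual metrics on the two boundaries, a quasi-symmetry onto its image. In particular, the metric Morse boundary is independent of the choice of basepoint up to quasi-symmetric equivalence. -/

import Mathlib

open Set Filter

section Defs

variable {X : Type*} [MetricSpace X]

/-- A geodesic segment of length `L`, parametrized by arc length on `[0, L]`. -/
def IsGeodesicSeg (γ : ℝ → X) (L : ℝ) : Prop :=
  0 ≤ L ∧ ∀ s ∈ Icc (0:ℝ) L, ∀ t ∈ Icc (0:ℝ) L, dist (γ s) (γ t) = |s - t|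

/-- A geodesic from `x` to `y`, parametrized by arc length on `[0, dist x y]`. -/
def IsGeodesicFromTo (γ : ℝ → X) (x y : X) : Prop :=
  IsGeodesicSeg γ (dist x y) ∧ γ 0 = x ∧ γ (dist x y) = y

/-- A geodesic ray, parametrized by arc length on `[0, ∞)`. -/
def IsGeodesicRay (ℓ : ℝ → X) : Prop :=
  ∀ s ∈ Ici (0:ℝ), ∀ t ∈ Ici (0:ℝ), dist (ℓ s) (ℓ t) = |s - t|

/-- A geodesic metric space: any two points are joined by a geodesic. -/
def GeodesicSpace (X : Type*) [MetricSpace X] : Prop :=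
  ∀ x y : X, ∃ γ : ℝ → X, IsGeodesicFromTo γ x y

/-- A `(K, C)`-quasi-geodesic defined on the interval `I ⊆ ℝ`. -/
def IsQuasiGeodesicOn (K C : ℝ) (I : Set ℝ) (σ : ℝ → X) : Prop :=
  ∀ s ∈ I, ∀ t ∈ I,
    |s - t| / K - C ≤ dist (σ s) (σ t) ∧ dist (σ s) (σ t) ≤ K * |s - t| + C

/-- A Morse gauge: a nonnegative real `N K C` for every `K ≥ 1`, `C ≥ 0`. -/
def IsMorseGauge (N : ℝ → ℝ → ℝ) : Prop :=
  ∀ K C : ℝ, 1 ≤ K → 0 ≤ C → 0 ≤ N K C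

/-- A subset `G ⊆ X` is `N`-Morse if for all `K ≥ 1`, `C ≥ 0`, every
`(K,C)`-quasi-geodesic with endpoints on `G` is contained in the closed
`N K C`-neighbourhood of `G`. -/
def IsMorseSet (N : ℝ → ℝ → ℝ) (G : Set X) : Prop :=
  ∀ K C : ℝ, 1 ≤ K → 0 ≤ C → ∀ a b : ℝ, a ≤ b → ∀ σ : ℝ → X,
    IsQuasiGeodesicOn K C (Icc a b) σ → σ a ∈ G → σ b ∈ G →
    ∀ s ∈ Icc a b, ∃ g ∈ G, dist (σ s) g ≤ N K C

/-- An `N`-Morse geodesic from `x` to `y`. -/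
def IsMorseGeodesicFromTo (N : ℝ → ℝ → ℝ) (γ : ℝ → X) (x y : X) : Prop :=
  IsGeodesicFromTo γ x y ∧ IsMorseSet N (γ '' Icc 0 (dist x y))

/-- An `N`-Morse geodesic ray. -/
def IsMorseRay (N : ℝ → ℝ → ℝ) (ℓ : ℝ → X) : Prop :=
  IsGeodesicRay ℓ ∧ IsMorseSet N (ℓ '' Ici 0)

/-- The stratum `X^(N)_e`: points joined to `e` by an `N`-Morse geodesic. -/
def morseStratum (N : ℝ → ℝ → ℝ) (e : X) : Set X :=
  {y | ∃ γ : ℝ → X, IsMorseGeodesicFromTo N γ e y}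

/-- The Gromov product `(x·y)_w`. -/
noncomputable def gprod (w x y : X) : ℝ := (dist w x + dist w y - dist x y) / 2

/-- A `B`-quasi-convex subset: geodesics with endpoints in `Y` stay in the
closed `B`-neighbourhood of `Y`. -/
def IsQuasiConvex (B : ℝ) (Y : Set X) : Prop :=
  ∀ x ∈ Y, ∀ y ∈ Y, ∀ γ : ℝ → X, IsGeodesicFromTo γ x y →
    ∀ s ∈ Icc (0:ℝ) (dist x y), ∃ g ∈ Y, dist (γ s) g ≤ B

/-- An `N`-stable subset: quasi-convex, and any two of its points are joined
by an `N`-Morse geodesic of `X`. -/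
def IsStableSubset (N : ℝ → ℝ → ℝ) (Y : Set X) : Prop :=
  (∃ B : ℝ, 0 ≤ B ∧ IsQuasiConvex B Y) ∧
    ∀ x ∈ Y, ∀ y ∈ Y, ∃ γ : ℝ → X, IsMorseGeodesicFromTo N γ x y

variable {Y : Type*} [MetricSpace Y]

/-- A `(K,C)`-quasi-isometric embedding. -/
def IsQIEmbedding (K C : ℝ) (q : X → Y) : Prop :=
  ∀ x x' : X,
    dist x x' / K - C ≤ dist (q x) (q x') ∧ dist (q x) (q x') ≤ K * dist x x' + C

/-- A `(K,C)`-quasi-isometry. -/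
def IsQuasiIsometry (K C : ℝ) (q : X → Y) : Prop :=
  IsQIEmbedding K C q ∧ ∀ y : Y, ∃ x : X, dist y (q x) ≤ C

end Defs

section Boundary

variable {X : Type*} [MetricSpace X]

/-- A sequence converges at infinity with respect to the basepoint `e`. -/
def ConvAtInf (e : X) (f : ℕ → X) : Prop :=
  Tendsto (fun p : ℕ × ℕ => gprod e (f p.1) (f p.2)) atTop atTop

/-- Two sequences converging at infinity are equivalent. -/
def EquivAtInf (e : X) (f g : ℕ → X) : Prop :=
  Tendsto (fun p : ℕ × ℕ => gprod e (f p.1) (g p.2)) atTop atTop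

/-- Sequences in `S` converging at infinity. -/
abbrev BSeq (S : Set X) (e : X) : Type _ :=
  {f : ℕ → X // (∀ n, f n ∈ S) ∧ ConvAtInf e f}

/-- The sequential boundary of `S ⊆ X` with basepoint `e`: sequences in `S`
converging at infinity, up to equivalence. -/
def SeqBoundary (S : Set X) (e : X) : Type _ :=
  Quot (fun f g : BSeq S e => EquivAtInf e f.1 g.1)

/-- The boundary point represented by a convergent sequence. -/
def SeqBoundary.mk {S : Set X} {e : X} (f : BSeq S e) : SeqBoundary S e :=
  Quot.mk _ f

/-- The liminf of Gromov products of two sequences, valued in `EReal`. -/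
noncomputable def seqGP (e : X) (f g : ℕ → X) : EReal :=
  Filter.liminf (fun p : ℕ × ℕ => ((gprod e (f p.1) (g p.2) : ℝ) : EReal)) atTop

/-- The Gromov product of two boundary points: the supremum over representing
sequences of the liminf of Gromov products. -/
noncomputable def bGP (S : Set X) (e : X) (ξ η : SeqBoundary S e) : EReal :=
  sSup {r : EReal | ∃ f g : BSeq S e,
    SeqBoundary.mk f = ξ ∧ SeqBoundary.mk g = η ∧ r = seqGP e f.1 g.1}

open Classical in
/-- `exp (−ε·r)` for an extended real `r`, with value `0` at `r = ⊤`. -/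
noncomputable def visGauge (ε : ℝ) (r : EReal) : ℝ :=
  if r = ⊤ then 0 else Real.exp (-ε * r.toReal)

/-- `d` is a visual metric on the sequential boundary of `S`:
a metric comparable to `exp(−ε·(Gromov product))` for some parameter `ε > 0`. -/
def IsVisualMetric (S : Set X) (e : X)
    (d : SeqBoundary S e → SeqBoundary S e → ℝ) : Prop :=
  (∀ ξ η, 0 ≤ d ξ η) ∧ (∀ ξ η, d ξ η = d η ξ) ∧
  (∀ ξ η ζ, d ξ ζ ≤ d ξ η + d η ζ) ∧ (∀ ξ η, d ξ η = 0 ↔ ξ = η) ∧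
  ∃ ε : ℝ, 0 < ε ∧ ∃ k₁ : ℝ, 0 < k₁ ∧ ∃ k₂ : ℝ, 0 < k₂ ∧
    ∀ ξ η, k₁ * visGauge ε (bGP S e ξ η) ≤ d ξ η ∧
      d ξ η ≤ k₂ * visGauge ε (bGP S e ξ η)

/-- `η` is (the restriction of) a self-homeomorphism of `[0,∞)`. -/
def IsHomeoIci (η : ℝ → ℝ) : Prop :=
  ContinuousOn η (Ici 0) ∧ StrictMonoOn η (Ici 0) ∧ η 0 = 0 ∧
    Tendsto η atTop atTop ∧ ∀ t ∈ Ici (0:ℝ), 0 ≤ η t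

/-- `F` is a quasi-symmetry onto its image, for the "distances" `dA`, `dB`. -/
def IsQuasiSymmetryOnto {A B : Type*} (dA : A → A → ℝ) (dB : B → B → ℝ)
    (F : A → B) : Prop :=
  Function.Injective F ∧ ∃ η : ℝ → ℝ, IsHomeoIci η ∧
    ∀ x y z : A, x ≠ y → x ≠ z → y ≠ z →
      dB (F x) (F y) / dB (F x) (F z) ≤ η (dA x y / dA x z)

end Boundary

/-- `X` (with basepoint `x`) is stably subsumed by `Y` (with basepoint `y`):
every stratum of `X` quasi-isometrically embeds in some stratum of `Y`. -/
def StablySubsumed (X Y : Type*) [MetricSpace X] [MetricSpace Y]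
    (x : X) (y : Y) : Prop :=
  ∀ N : ℝ → ℝ → ℝ, IsMorseGauge N →
    ∃ N' : ℝ → ℝ → ℝ, IsMorseGauge N' ∧
      ∃ K C : ℝ, 1 ≤ K ∧ 0 ≤ C ∧ ∃ f : X → Y,
        (∀ a ∈ morseStratum N x, f a ∈ morseStratum N' y) ∧
        ∀ a ∈ morseStratum N x, ∀ b ∈ morseStratum N x,
          dist a b / K - C ≤ dist (f a) (f b) ∧ dist (f a) (f b) ≤ K * dist a b + C

/-- Durham–Taylor stability of `f : Y → X`. -/
def DTStable {Y X : Type*} [MetricSpace Y] [MetricSpace X] (f : Y → X) : Prop :=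
  ∀ K C : ℝ, 1 ≤ K → 0 ≤ C → ∃ R : ℝ, 0 ≤ R ∧
    ∀ a₁ b₁ a₂ b₂ : ℝ, a₁ ≤ b₁ → a₂ ≤ b₂ → ∀ σ₁ σ₂ : ℝ → X,
      IsQuasiGeodesicOn K C (Icc a₁ b₁) σ₁ → IsQuasiGeodesicOn K C (Icc a₂ b₂) σ₂ →
      σ₁ a₁ = σ₂ a₂ → σ₁ b₁ = σ₂ b₂ →
      σ₁ a₁ ∈ Set.range f → σ₁ b₁ ∈ Set.range f →
      (∀ s ∈ Icc a₁ b₁, ∃ t ∈ Icc a₂ b₂, dist (σ₁ s) (σ₂ t) ≤ R) ∧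
      (∀ t ∈ Icc a₂ b₂, ∃ s ∈ Icc a₁ b₁, dist (σ₁ s) (σ₂ t) ≤ R)

section Helpers

theorem morse_basepoint {X : Type*} [MetricSpace X] (hX : GeodesicSpace X)
    (N : ℝ → ℝ → ℝ) (e f : X) (R D : ℝ) (hD : dist e f = D)
    (hR1 : N 1 D ≤ R) (hR2 : D ≤ R) (N' : ℝ → ℝ → ℝ)
    (hN' : ∀ K C, 1 ≤ K → 0 ≤ C → N K (C + 2 * R) + 2 * R + 2 * D ≤ N' K C)
    (hN'0 : IsMorseGauge N') :
    morseStratum N e ⊆ morseStratum N' f := by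
  rintro y ⟨γ, ⟨⟨hL, hγ⟩, hγ0, hγ1⟩, hM⟩
  obtain ⟨γ', ⟨hL', hγ'⟩, hγ'0, hγ'1⟩ := hX f y
  have hD0 : 0 ≤ D := hD ▸ dist_nonneg
  have hR0 : 0 ≤ R := hD0.trans hR2
  set L := dist e y with hLdef
  set L' := dist f y with hL'def
  have hLL1 : L ≤ D + L' := by rw [← hD]; exact dist_triangle _ _ _
  have hLL2 : L' ≤ D + L := by rw [← hD, dist_comm e f]; exact dist_triangle _ _ _
  have he : e ∈ γ '' Icc 0 L := ⟨0, ⟨le_rfl, hL⟩, hγ0⟩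
  have hy : y ∈ γ '' Icc 0 L := ⟨L, ⟨hL, le_rfl⟩, hγ1⟩
  have near : ∀ t ∈ Icc (0:ℝ) L', ∃ g ∈ γ '' Icc 0 L, dist (γ' t) g ≤ R := by
    intro t ht
    rcases eq_or_lt_of_le ht.1 with h0 | h0
    · refine ⟨e, he, ?_⟩
      rw [← h0, hγ'0, dist_comm, hD]; exact hR2
    let σ : ℝ → X := fun t => if t = 0 then e else γ' t
    have hclose : ∀ t, dist (σ t) (γ' t) ≤ D ∧ (t ≠ 0 → σ t = γ' t) := by
      intro t
      by_cases h : t = 0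
      · subst h; simp [σ, hγ'0, hD]
      · simp [σ, h, hD0]
    have hq : IsQuasiGeodesicOn 1 D (Icc 0 L') σ := by
      intro a ha b hb
      have h1 := hγ' a ha b hb
      have h2 : abs (dist (σ a) (σ b) - abs (a - b)) ≤ D := by
        rw [← h1]
        by_cases haz : a = 0
        · by_cases hbz : b = 0
          · rw [haz, hbz]; simpa using hD0
          · rw [(hclose b).2 hbz]
            exact (abs_dist_sub_le _ _ _).trans (hclose a).1
        · rw [(hclose a).2 haz, dist_comm (γ' a), dist_comm (γ' a)]
          exact (abs_dist_sub_le _ _ _).trans (hclose b).1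
      rw [abs_le] at h2
      constructor <;> [rw [div_one]; rw [one_mul]] <;> linarith
    have hLy : σ L' = y := by
      rw [(hclose L').2 (by linarith [ht.2]), hγ'1]
    obtain ⟨g, hg, hd⟩ := hM 1 D le_rfl hD0 0 L' hL' σ hq (by simpa [σ] using he)
      (by rw [hLy]; exact hy) t ht
    rw [(hclose t).2 h0.ne'] at hd
    exact ⟨g, hg, hd.trans hR1⟩
  have near' : ∀ g ∈ γ '' Icc 0 L, ∃ g' ∈ γ' '' Icc 0 L', dist g g' ≤ 2 * R + 2 * D := by
    rintro _ ⟨s, hs, rfl⟩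
    have ht : min s L' ∈ Icc (0:ℝ) L' := ⟨le_min hs.1 hL', min_le_right _ _⟩
    have hst : |s - min s L'| ≤ D := by
      rw [abs_of_nonneg (by linarith [min_le_left s L'])]
      rcases le_total s L' with h | h
      · rw [min_eq_left h]; linarith
      · rw [min_eq_right h]; linarith [hs.2]
    obtain ⟨_, ⟨u, hu, rfl⟩, hd⟩ := near _ ht
    refine ⟨γ' (min s L'), ⟨_, ht, rfl⟩, ?_⟩
    set t := min s L'
    have h1 : dist e (γ u) = u := by
      rw [← hγ0, hγ 0 ⟨le_rfl, hL⟩ u hu, zero_sub, abs_neg, abs_of_nonneg hu.1]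
    have h2 : dist f (γ' t) = t := by
      rw [← hγ'0, hγ' 0 ⟨le_rfl, hL'⟩ t ht, zero_sub, abs_neg, abs_of_nonneg ht.1]
    have h3 := dist_triangle4 e f (γ' t) (γ u)
    have h4 := dist_triangle4 f e (γ u) (γ' t)
    rw [dist_comm f e, dist_comm (γ u)] at h4
    have h5 : |t - u| ≤ D + R := by rw [abs_le]; constructor <;> linarith
    have h6 := hγ s hs u hu
    have h7 := abs_sub_le s t u
    have h8 := dist_triangle (γ s) (γ u) (γ' t)
    rw [dist_comm (γ u)] at h8
    linarith
  refine ⟨γ', ⟨⟨hL', hγ'⟩, hγ'0, hγ'1⟩, ?_⟩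
  intro K C hK hC a b hab σ hσ hσa hσb s hs
  by_cases hsa : s = a
  · exact ⟨σ a, hσa, by rw [hsa, dist_self]; exact hN'0 K C hK hC⟩
  by_cases hsb : s = b
  · exact ⟨σ b, hσb, by rw [hsb, dist_self]; exact hN'0 K C hK hC⟩
  have hab' : a ≠ b := by
    rintro rfl
    exact hsa (le_antisymm hs.2 hs.1)
  obtain ⟨pa, hpa, hda⟩ : ∃ g ∈ γ '' Icc 0 L, dist (σ a) g ≤ R := by
    obtain ⟨t, ht, h⟩ := hσa
    rw [← h]; exact near t ht
  obtain ⟨pb, hpb, hdb⟩ : ∃ g ∈ γ '' Icc 0 L, dist (σ b) g ≤ R := by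
    obtain ⟨t, ht, h⟩ := hσb
    rw [← h]; exact near t ht
  let τ : ℝ → X := fun t => if t = a then pa else if t = b then pb else σ t
  have hτ : ∀ t, dist (τ t) (σ t) ≤ R := by
    intro t
    by_cases h : t = a
    · subst h; simpa [τ, dist_comm] using hda
    · by_cases h' : t = b
      · subst h'; simpa [τ, h, dist_comm] using hdb
      · simpa [τ, h, h'] using hR0
  have hq : IsQuasiGeodesicOn K (C + 2 * R) (Icc a b) τ := by
    intro u hu v hv
    obtain ⟨h1, h2⟩ := hσ u hu v hv
    have h3 := dist_triangle4 (τ u) (σ u) (σ v) (τ v)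
    have h4 := dist_triangle4 (σ u) (τ u) (τ v) (σ v)
    have h5 := hτ u
    have h6 := hτ v
    rw [dist_comm (σ u) (τ u)] at h4
    rw [dist_comm (σ v) (τ v)] at h3
    constructor <;> linarith
  obtain ⟨g, hg, hd⟩ := hM K (C + 2 * R) hK (by linarith) a b hab τ hq
    (by simpa [τ] using hpa) (by simpa [τ, hab'.symm] using hpb) s hs
  obtain ⟨g', hg', hd'⟩ := near' g hg
  have hτs : τ s = σ s := by simp [τ, hsa, hsb]
  rw [hτs] at hd
  refine ⟨g', hg', ?_⟩
  have := dist_triangle (σ s) g g'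
  have := hN' K C hK hC
  linarith

theorem proj_close {X : Type*} [MetricSpace X] (N : ℝ → ℝ → ℝ) (e p x : X)
    (g h α : ℝ → X) (hg : IsGeodesicFromTo g e p) (hh : IsGeodesicFromTo h p x)
    (hα : IsMorseGeodesicFromTo N α e x)
    (hmin : ∀ u ∈ Icc (0:ℝ) (dist p x), dist e p ≤ dist e (h u)) (t : ℝ)
    (ht : t ∈ Icc (0:ℝ) (dist e p)) : dist (g t) (α t) ≤ 2 * N 3 0 := by
  obtain ⟨⟨hr, hg⟩, hg0, hg1⟩ := hg
  obtain ⟨⟨hl, hh⟩, hh0, hh1⟩ := hh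
  obtain ⟨⟨⟨hL, hα⟩, hα0, hα1⟩, hM⟩ := hα
  have hrL : dist e p ≤ dist e x := by
    have := hmin _ ⟨hl, le_rfl⟩
    rwa [hh1] at this
  set r := dist e p
  set l := dist p x
  set L := dist e x
  let σ : ℝ → X := fun t => if t ≤ r then g t else h (t - r)
  have hσ1 : ∀ t, t ≤ r → σ t = g t := fun t ht => by simp [σ, ht]
  have hσ2 : ∀ t, r < t → σ t = h (t - r) := fun t ht => by simp [σ, not_le.2 ht]
  have key : ∀ s, 0 ≤ s → s ≤ r → ∀ u, 0 ≤ u → u ≤ l →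
      dist (g s) (h u) ≤ u + (r - s) ∧ u + (r - s) ≤ 3 * dist (g s) (h u) := by
    intro s hs0 hs1 u hu0 hu1
    have h1 : dist (g s) p = r - s := by
      rw [← hg1, hg s ⟨hs0, hs1⟩ r ⟨hr, le_rfl⟩, abs_sub_comm, abs_of_nonneg (by linarith)]
    have h2 : dist p (h u) = u := by
      rw [← hh0, hh 0 ⟨le_rfl, hl⟩ u ⟨hu0, hu1⟩, zero_sub, abs_neg, abs_of_nonneg hu0]
    have h3 : dist e (g s) = s := by
      rw [← hg0, hg 0 ⟨le_rfl, hr⟩ s ⟨hs0, hs1⟩, zero_sub, abs_neg, abs_of_nonneg hs0]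
    have h4 := hmin u ⟨hu0, hu1⟩
    have h5 := dist_triangle e (g s) (h u)
    have h6 := dist_triangle (g s) p (h u)
    have h7 := dist_triangle p (g s) (h u)
    rw [dist_comm p (g s)] at h7
    constructor <;> linarith
  have key2 : ∀ s t, 0 ≤ s → s ≤ t → t ≤ r + l →
      dist (σ s) (σ t) ≤ t - s ∧ t - s ≤ 3 * dist (σ s) (σ t) := by
    intro s t h0 hst htl
    rcases le_or_gt t r with h | h
    · rw [hσ1 t h, hσ1 s (hst.trans h), hg s ⟨h0, hst.trans h⟩ t ⟨h0.trans hst, h⟩, abs_sub_comm,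
        abs_of_nonneg (by linarith)]
      constructor <;> linarith
    · rcases le_or_gt s r with h' | h'
      · rw [hσ2 t h, hσ1 s h']
        have := key s h0 h' (t - r) (by linarith) (by linarith)
        constructor <;> linarith
      · rw [hσ2 t h, hσ2 s h', hh (s - r) ⟨by linarith, by linarith⟩ (t - r)
          ⟨by linarith, by linarith⟩, abs_sub_comm, abs_of_nonneg (by linarith)]
        constructor <;> linarith
  have hq : IsQuasiGeodesicOn 3 0 (Icc 0 (r + l)) σ := by
    intro s hs t ht
    have h : dist (σ s) (σ t) ≤ |s - t| ∧ |s - t| ≤ 3 * dist (σ s) (σ t) := by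
      rcases le_total s t with h | h
      · rw [abs_sub_comm, abs_of_nonneg (by linarith)]
        exact key2 s t hs.1 h ht.2
      · rw [dist_comm, abs_of_nonneg (by linarith)]
        exact key2 t s ht.1 h hs.2
    have := abs_nonneg (s - t)
    constructor <;> linarith [h.1, h.2]
  have hσe : σ (r + l) = x := by
    rcases eq_or_lt_of_le hl with h | h
    · rw [← h, add_zero, hσ1 r le_rfl, hg1]
      have : dist p x = 0 := h.symm
      exact dist_eq_zero.1 this
    · rw [hσ2 _ (by linarith), add_sub_cancel_left, hh1]
  obtain ⟨_, ⟨u, hu, rfl⟩, hd⟩ := hM 3 0 (by norm_num) le_rfl 0 (r + l) (by linarith) σ hq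
    (by rw [hσ1 0 hr, hg0, ← hα0]; exact ⟨0, ⟨le_rfl, hL⟩, rfl⟩)
    (by rw [hσe, ← hα1]; exact ⟨L, ⟨hL, le_rfl⟩, rfl⟩) t ⟨ht.1, by linarith [ht.2]⟩
  rw [hσ1 t ht.2] at hd
  have h1 : dist e (α u) = u := by
    rw [← hα0, hα 0 ⟨le_rfl, hL⟩ u hu, zero_sub, abs_neg, abs_of_nonneg hu.1]
  have h2 : dist e (g t) = t := by
    rw [← hg0, hg 0 ⟨le_rfl, hr⟩ t ht, zero_sub, abs_neg, abs_of_nonneg ht.1]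
  have h3 := dist_triangle e (g t) (α u)
  have h4 := dist_triangle e (α u) (g t)
  rw [dist_comm (α u)] at h4
  have h5 : |u - t| ≤ N 3 0 := by rw [abs_le]; constructor <;> linarith
  have h6 := hα u hu t ⟨ht.1, ht.2.trans hrL⟩
  have h7 := dist_triangle (g t) (α u) (α t)
  linarith

theorem gprod_nonneg {X : Type*} [MetricSpace X] (w x y : X) : 0 ≤ gprod w x y := by
  unfold gprod
  have := dist_triangle x w y
  rw [dist_comm x w] at this
  linarith

theorem gprod_comm {X : Type*} [MetricSpace X] (w x y : X) : gprod w x y = gprod w y x := by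
  unfold gprod
  rw [dist_comm x y]; ring

theorem gprod_le_left {X : Type*} [MetricSpace X] (w x y : X) : gprod w x y ≤ dist w x := by
  unfold gprod
  have := dist_triangle w x y
  linarith

theorem gprod_le_right {X : Type*} [MetricSpace X] (w x y : X) : gprod w x y ≤ dist w y := by
  rw [gprod_comm]; exact gprod_le_left _ _ _

theorem gprod_base {X : Type*} [MetricSpace X] (e f x y : X) :
    gprod e x y ≤ gprod f x y + dist e f := by
  unfold gprod
  have := dist_triangle e f x
  have := dist_triangle e f y
  linarith

theorem fellow {X : Type*} [MetricSpace X] (hX : GeodesicSpace X) (N : ℝ → ℝ → ℝ) (e x y : X)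
    (α β : ℝ → X) (hα : IsMorseGeodesicFromTo N α e x) (hβ : IsMorseGeodesicFromTo N β e y)
    (t : ℝ) (ht0 : 0 ≤ t) (ht : t ≤ gprod e x y) : dist (α t) (β t) ≤ 4 * N 3 0 := by
  obtain ⟨c, ⟨hL, hc⟩, hc0, hc1⟩ := hX x y
  have hcont : ContinuousOn (fun s => dist e (c s)) (Icc 0 (dist x y)) := by
    refine (continuous_const.dist continuous_id).comp_continuousOn (f := c) (g := fun z => dist e z) ?_
    rw [Metric.continuousOn_iff]
    intro b hb ε hε
    exact ⟨ε, hε, fun a ha hab => by rw [hc a ha b hb]; exact hab⟩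
  obtain ⟨w, hw, hwmin⟩ := isCompact_Icc.exists_isMinOn ⟨0, ⟨le_rfl, hL⟩⟩ hcont
  have hmin : ∀ s ∈ Icc (0:ℝ) (dist x y), dist e (c w) ≤ dist e (c s) := fun s hs => hwmin hs
  set p := c w with hp
  have hpx : dist p x = w := by
    rw [← hc0, hc w hw 0 ⟨le_rfl, hL⟩, sub_zero, abs_of_nonneg hw.1]
  have hpy : dist p y = dist x y - w := by
    conv_lhs => rw [← hc1]
    rw [hc w hw _ ⟨hL, le_rfl⟩, abs_sub_comm, abs_of_nonneg (by linarith [hw.2])]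
  obtain ⟨g, hg⟩ := hX e p
  have htr : t ∈ Icc (0:ℝ) (dist e p) := by
    refine ⟨ht0, ht.trans ?_⟩
    unfold gprod
    have := dist_triangle e p x
    have := dist_triangle e p y
    linarith
  have h1 : IsGeodesicFromTo (fun u => c (w - u)) p x := by
    refine ⟨⟨dist_nonneg, ?_⟩, by simp [hp], by simp [hpx, hc0]⟩
    intro s hs t ht
    rw [hpx] at hs ht
    have := hc (w - s) ⟨by linarith [hs.2], by linarith [hs.1, hw.2]⟩ (w - t)
      ⟨by linarith [ht.2], by linarith [ht.1, hw.2]⟩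
    simp only [this]
    rw [abs_sub_comm]; congr 1; ring
  have h2 : IsGeodesicFromTo (fun u => c (w + u)) p y := by
    refine ⟨⟨dist_nonneg, ?_⟩, by simp [hp], by simp [hpy, hc1]⟩
    intro s hs t ht
    rw [hpy] at hs ht
    have := hc (w + s) ⟨by linarith [hs.1, hw.1], by linarith [hs.2]⟩ (w + t)
      ⟨by linarith [ht.1, hw.1], by linarith [ht.2]⟩
    simp only [this]
    congr 1; ring
  have h3 := proj_close N e p x g _ α hg h1 hα (fun u hu => by
    rw [hpx] at hu
    exact hmin _ ⟨by linarith [hu.2], by linarith [hu.1, hw.2]⟩) t htr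
  have h4 := proj_close N e p y g _ β hg h2 hβ (fun u hu => by
    rw [hpy] at hu
    exact hmin _ ⟨by linarith [hu.1, hw.1], by linarith [hu.2]⟩) t htr
  have h5 := dist_triangle (α t) (g t) (β t)
  rw [dist_comm (α t) (g t)] at h5
  linarith

theorem hyp {X : Type*} [MetricSpace X] (hX : GeodesicSpace X) (N : ℝ → ℝ → ℝ) (e x y z : X)
    (hx : x ∈ morseStratum N e) (hy : y ∈ morseStratum N e) (hz : z ∈ morseStratum N e) (c : ℝ)
    (h1 : c ≤ gprod e x y) (h2 : c ≤ gprod e y z) : c - 4 * N 3 0 ≤ gprod e x z := by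
  obtain ⟨α, hα⟩ := hx
  obtain ⟨β, hβ⟩ := hy
  obtain ⟨γ, hγ⟩ := hz
  set t := max c 0
  have ht0 : 0 ≤ t := le_max_right _ _
  have hct : c ≤ t := le_max_left _ _
  have ht1 : t ≤ gprod e x y := max_le h1 (gprod_nonneg _ _ _)
  have ht2 : t ≤ gprod e y z := max_le h2 (gprod_nonneg _ _ _)
  have h3 := fellow hX N e x y α β hα hβ t ht0 ht1
  have h4 := fellow hX N e y z β γ hβ hγ t ht0 ht2
  have h5 := dist_triangle (α t) (β t) (γ t)
  have htx : t ≤ dist e x := ht1.trans (gprod_le_left _ _ _)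
  have htz : t ≤ dist e z := ht2.trans (gprod_le_right _ _ _)
  have h6 : dist (α t) x = dist e x - t := by
    have := hα.1.1.2 t ⟨ht0, htx⟩ _ ⟨dist_nonneg, le_rfl⟩
    rw [hα.1.2.2] at this
    rw [this, abs_sub_comm, abs_of_nonneg (by linarith)]
  have h7 : dist (γ t) z = dist e z - t := by
    have := hγ.1.1.2 t ⟨ht0, htz⟩ _ ⟨dist_nonneg, le_rfl⟩
    rw [hγ.1.2.2] at this
    rw [this, abs_sub_comm, abs_of_nonneg (by linarith)]
  have h8 := dist_triangle4 x (α t) (γ t) z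
  rw [dist_comm x (α t)] at h8
  unfold gprod
  linarith

theorem ev_prod_iff (P : ℕ → ℕ → Prop) :
    (∀ᶠ p : ℕ × ℕ in atTop, P p.1 p.2) ↔ ∃ n0, ∀ n ≥ n0, ∀ m ≥ n0, P n m := by
  rw [eventually_atTop]
  constructor
  · rintro ⟨⟨a, b⟩, h⟩
    exact ⟨max a b, fun n hn m hm => h (n, m)
      ⟨(le_max_left _ _).trans hn, (le_max_right _ _).trans hm⟩⟩
  · rintro ⟨n0, h⟩
    exact ⟨(n0, n0), fun p hp => h _ hp.1 _ hp.2⟩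

theorem equivAtInf_iff {X : Type*} [MetricSpace X] (e : X) (u v : ℕ → X) :
    EquivAtInf e u v ↔ ∀ M, ∃ n0, ∀ n ≥ n0, ∀ m ≥ n0, M ≤ gprod e (u n) (v m) := by
  unfold EquivAtInf
  rw [tendsto_atTop]
  exact forall_congr' fun M => ev_prod_iff (fun n m => M ≤ gprod e (u n) (v m))

theorem equivAtInf_base {X : Type*} [MetricSpace X] (e f : X) (u v : ℕ → X)
    (h : EquivAtInf e u v) : EquivAtInf f u v := by
  rw [equivAtInf_iff] at *
  intro M
  obtain ⟨n0, h⟩ := h (M + dist e f)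
  exact ⟨n0, fun n hn m hm => by linarith [h n hn m hm, gprod_base e f (u n) (v m)]⟩

theorem equivAtInf_symm {X : Type*} [MetricSpace X] (e : X) (u v : ℕ → X)
    (h : EquivAtInf e u v) : EquivAtInf e v u := by
  rw [equivAtInf_iff] at *
  intro M
  obtain ⟨n0, h⟩ := h M
  exact ⟨n0, fun n hn m hm => by rw [gprod_comm]; exact h m hm n hn⟩

theorem mk_exact {X : Type*} [MetricSpace X] (hX : GeodesicSpace X) (N : ℝ → ℝ → ℝ) (e : X)
    (u v : BSeq (morseStratum N e) e) (h : SeqBoundary.mk u = SeqBoundary.mk v) :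
    EquivAtInf e u.1 v.1 := by
  have h' := Quot.eqvGen_exact h
  clear h
  induction h' with
  | rel _ _ h => exact h
  | refl x => exact x.2.2
  | symm x y _ ih => exact equivAtInf_symm _ _ _ ih
  | trans x y z _ _ h1 h2 =>
    rw [equivAtInf_iff] at *
    intro M
    obtain ⟨n1, h1⟩ := h1 (M + 4 * N 3 0)
    obtain ⟨n2, h2⟩ := h2 (M + 4 * N 3 0)
    refine ⟨max n1 n2, fun n hn m hm => ?_⟩
    have := hyp hX N e _ _ _ (x.2.1 n) (y.2.1 (max n1 n2)) (z.2.1 m) _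
      (h1 n (le_of_max_le_left hn) _ (le_max_left _ _))
      (h2 _ (le_max_right _ _) m (le_of_max_le_right hm))
    linarith

theorem lt_seqGP {X : Type*} [MetricSpace X] (e : X) (u v : ℕ → X) (c : ℝ)
    (h : (c : EReal) < seqGP e u v) : ∃ n0, ∀ n ≥ n0, ∀ m ≥ n0, c ≤ gprod e (u n) (v m) := by
  rw [← ev_prod_iff (fun n m => c ≤ gprod e (u n) (v m))]
  filter_upwards [eventually_lt_of_lt_liminf h] with p hp
  exact (EReal.coe_lt_coe_iff.1 hp).le

theorem le_seqGP {X : Type*} [MetricSpace X] (e : X) (u v : ℕ → X) (c : ℝ)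
    (h : ∃ n0, ∀ n ≥ n0, ∀ m ≥ n0, c ≤ gprod e (u n) (v m)) : (c : EReal) ≤ seqGP e u v := by
  rw [← ev_prod_iff (fun n m => c ≤ gprod e (u n) (v m))] at h
  refine le_liminf_of_le (by isBoundedDefault) ?_
  filter_upwards [h] with p hp
  exact EReal.coe_le_coe_iff.2 hp

theorem le_bGP {X : Type*} [MetricSpace X] (S : Set X) (e : X) (u v : BSeq S e) (c : ℝ)
    (h : ∃ n0, ∀ n ≥ n0, ∀ m ≥ n0, c ≤ gprod e (u.1 n) (v.1 m)) :
    (c : EReal) ≤ bGP S e (SeqBoundary.mk u) (SeqBoundary.mk v) :=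
  (le_seqGP e u.1 v.1 c h).trans (le_sSup ⟨u, v, rfl, rfl, rfl⟩)

theorem bGP_nonneg {X : Type*} [MetricSpace X] (S : Set X) (e : X) (ξ η : SeqBoundary S e) :
    0 ≤ bGP S e ξ η := by
  induction ξ using Quot.ind with | _ u
  induction η using Quot.ind with | _ v
  exact_mod_cast le_bGP S e u v 0 ⟨0, fun n _ m _ => gprod_nonneg _ _ _⟩

theorem lt_bGP {X : Type*} [MetricSpace X] (S : Set X) (e : X) (ξ η : SeqBoundary S e) (c : ℝ)
    (h : (c : EReal) < bGP S e ξ η) : ∃ u v : BSeq S e, SeqBoundary.mk u = ξ ∧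
      SeqBoundary.mk v = η ∧ ∃ n0, ∀ n ≥ n0, ∀ m ≥ n0, c ≤ gprod e (u.1 n) (v.1 m) := by
  obtain ⟨_, ⟨u, v, hu, hv, rfl⟩, h⟩ := lt_sSup_iff.1 h
  exact ⟨u, v, hu, hv, lt_seqGP _ _ _ _ h⟩

/-- The induced map on boundaries. -/
def bmap {X : Type*} [MetricSpace X] (S S' : Set X) (e f : X) (hS : S ⊆ S') :
    SeqBoundary S e → SeqBoundary S' f :=
  Quot.map (fun u => ⟨u.1, fun n => hS (u.2.1 n), equivAtInf_base e f _ _ u.2.2⟩)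
    (fun _ _ h => equivAtInf_base e f _ _ h)

theorem ereal_compare (a b : EReal) (E : ℝ) (ha : 0 ≤ a) (hb : 0 ≤ b) (ha' : a ≠ ⊤) (hb' : b ≠ ⊤)
    (h : ∀ c : ℝ, (c : EReal) < a → ((c - E : ℝ) : EReal) ≤ b) :
    a.toReal - E ≤ b.toReal := by
  lift a to ℝ using ⟨ha', fun h => by simp [h] at ha⟩
  lift b to ℝ using ⟨hb', fun h => by simp [h] at hb⟩
  simp only [EReal.toReal_coe]
  refine le_of_forall_pos_le_add fun ε hε => ?_
  have := h (a - ε) (EReal.coe_lt_coe_iff.2 (by linarith))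
  have := EReal.coe_le_coe_iff.1 this
  linarith

theorem visual_ne_top {X : Type*} [MetricSpace X] (S : Set X) (e : X)
    (d : SeqBoundary S e → SeqBoundary S e → ℝ) (k ε : ℝ) (ξ η : SeqBoundary S e)
    (h : d ξ η ≤ k * visGauge ε (bGP S e ξ η)) (hd : 0 < d ξ η) : bGP S e ξ η ≠ ⊤ := by
  intro h'
  rw [h'] at h
  simp [visGauge] at h
  linarith

/-- The numerical estimate behind quasi-symmetry. -/
theorem qs_estimate (ε ε' k₁ k₂ k₁' k₂' E P Q P' Q' a b a' b' : ℝ) (hε : 0 < ε) (hε' : 0 < ε')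
    (hk₁ : 0 < k₁) (hk₂ : 0 < k₂) (hk₁' : 0 < k₁') (hk₂' : 0 < k₂')
    (hP : P - E ≤ P') (hQ : Q' - E ≤ Q)
    (ha : k₁ * Real.exp (-ε * P) ≤ a)
    (hb : b ≤ k₂ * Real.exp (-ε * Q)) (hb0 : 0 < b)
    (ha' : a' ≤ k₂' * Real.exp (-ε' * P')) (hb' : k₁' * Real.exp (-ε' * Q') ≤ b') :
    a' / b' ≤ (k₂' / k₁' * Real.exp (2 * ε' * E)) * (k₂ / k₁ * (a / b)) ^ (ε' / ε) := by
  have h1 : Real.exp (-ε * (P - Q)) ≤ k₂ / k₁ * (a / b) := by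
    rw [div_mul_div_comm, le_div_iff₀ (by positivity)]
    calc Real.exp (-ε * (P - Q)) * (k₁ * b)
        ≤ Real.exp (-ε * (P - Q)) * (k₁ * (k₂ * Real.exp (-ε * Q))) := by gcongr
      _ = k₂ * (k₁ * (Real.exp (-ε * (P - Q)) * Real.exp (-ε * Q))) := by ring
      _ = k₂ * (k₁ * Real.exp (-ε * P)) := by rw [← Real.exp_add]; ring_nf
      _ ≤ k₂ * a := by gcongr
  have h2 : Real.exp (-ε' * (P - Q)) ≤ (k₂ / k₁ * (a / b)) ^ (ε' / ε) := by
    refine le_trans (le_of_eq ?_) (Real.rpow_le_rpow (Real.exp_pos _).le h1 (by positivity))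
    rw [← Real.exp_mul]
    congr 1
    field_simp
  have hb'0 : 0 < b' := lt_of_lt_of_le (by positivity) hb'
  refine le_trans ?_ (mul_le_mul_of_nonneg_left h2 (by positivity))
  rw [div_le_iff₀ hb'0]
  calc a' ≤ k₂' * Real.exp (-ε' * P') := ha'
    _ ≤ k₂' * Real.exp (2 * ε' * E + -ε' * (P - Q) + -ε' * Q') := by
        have : -ε' * P' ≤ 2 * ε' * E + -ε' * (P - Q) + -ε' * Q' := by nlinarith
        gcongr
    _ = k₂' / k₁' * Real.exp (2 * ε' * E) * Real.exp (-ε' * (P - Q))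
          * (k₁' * Real.exp (-ε' * Q')) := by
        rw [Real.exp_add, Real.exp_add]; field_simp
    _ ≤ _ := by gcongr

theorem homeo_pow (A B q : ℝ) (hA : 0 < A) (hB : 0 < B) (hq : 0 < q) :
    IsHomeoIci (fun t => A * (B * t) ^ q) := by
  refine ⟨?_, ?_, ?_, ?_, ?_⟩
  · refine Continuous.continuousOn ?_
    exact continuous_const.mul ((continuous_const.mul continuous_id).rpow_const
      (fun _ => Or.inr hq.le))
  · intro s hs t ht hst
    have hs : 0 ≤ s := hs
    have : (B * s) ^ q < (B * t) ^ q :=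
      Real.rpow_lt_rpow (by positivity) (mul_lt_mul_of_pos_left hst hB) hq
    exact mul_lt_mul_of_pos_left this hA
  · simp [Real.zero_rpow hq.ne']
  · exact ((tendsto_rpow_atTop hq).comp (tendsto_id.const_mul_atTop hB)).const_mul_atTop hA
  · intro t ht
    have ht : 0 ≤ t := ht
    positivity

end Helpers

/-- change of basepoint. For every Morse gauge `N` and every value
`D` of `dist e f` there is `N'` (depending only on `N` and `D`) with
`X^(N)_e ⊆ X^(N')_f`, and the induced injection of sequential boundaries is a
quasi-symmetry onto its image for any visual metrics. -/
theorem statement7 (N : ℝ → ℝ → ℝ) (hN : IsMorseGauge N) (D : ℝ) :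
    ∃ N' : ℝ → ℝ → ℝ, IsMorseGauge N' ∧
      ∀ (X : Type*) [MetricSpace X], GeodesicSpace X →
        ∀ e f : X, dist e f = D →
          morseStratum N e ⊆ morseStratum N' f ∧
          ∃ ι : SeqBoundary (morseStratum N e) e →
              SeqBoundary (morseStratum N' f) f,
            (∀ (u : BSeq (morseStratum N e) e) (v : BSeq (morseStratum N' f) f),
                (∀ n, v.1 n = u.1 n) →
                ι (SeqBoundary.mk u) = SeqBoundary.mk v) ∧
            Function.Injective ι ∧
            ∀ d d', IsVisualMetric (morseStratum N e) e d →
              IsVisualMetric (morseStratum N' f) f d' →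
              IsQuasiSymmetryOnto d d' ι := by
  refine ⟨fun K C => N K (C + 2 * (max (N 1 |D|) |D|)) + 2 * (max (N 1 |D|) |D|) + 2 * |D|, ?_, ?_⟩
  · intro K C hK hC
    have h1 : 0 ≤ max (N 1 |D|) |D| := (abs_nonneg D).trans (le_max_right _ _)
    have h2 := hN K (C + 2 * (max (N 1 |D|) |D|)) hK (by linarith)
    have := abs_nonneg D
    simp only
    linarith
  intro X _ hX e f hef
  have hD0 : 0 ≤ D := hef ▸ dist_nonneg
  rw [abs_of_nonneg hD0]
  set R := max (N 1 D) D with hR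
  set N' : ℝ → ℝ → ℝ := fun K C => N K (C + 2 * R) + 2 * R + 2 * D with hN'def
  have hR0 : 0 ≤ R := hD0.trans (le_max_right _ _)
  have hN' : IsMorseGauge N' := by
    intro K C hK hC
    have h2 := hN K (C + 2 * R) hK (by linarith)
    simp only [hN'def]
    linarith
  clear_value R
  have hS : morseStratum N e ⊆ morseStratum N' f :=
    morse_basepoint hX N e f R D hef (hR ▸ le_max_left _ _) (hR ▸ le_max_right _ _) N'
      (fun K C _ _ => le_rfl) hN'
  clear_value N'
  have hinj : Function.Injective (bmap (morseStratum N e) (morseStratum N' f) e f hS) := by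
    intro ξ η h
    induction ξ using Quot.ind with | _ u
    induction η using Quot.ind with | _ v
    have := mk_exact hX N' f _ _ h
    exact Quot.sound (equivAtInf_base f e _ _ this)
  refine ⟨hS, bmap _ _ e f hS, ?_, hinj, ?_⟩
  · intro u v huv
    have : v = ⟨u.1, fun n => hS (u.2.1 n), equivAtInf_base e f _ _ u.2.2⟩ :=
      Subtype.ext (funext huv)
    rw [this]
    rfl
  intro d d' hd hd'
  obtain ⟨hd0, -, -, hdz, ε, hε, k₁, hk₁, k₂, hk₂, hk⟩ := hd
  obtain ⟨hd0', -, -, hdz', ε', hε', k₁', hk₁', k₂', hk₂', hk'⟩ := hd'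
  set F := bmap (morseStratum N e) (morseStratum N' f) e f hS with hF
  set E := D + 8 * N' 3 0 with hE
  have hδ : 0 ≤ N' 3 0 := hN' 3 0 (by norm_num) le_rfl
  have cmp1 : ∀ ξ η, ∀ c : ℝ, (c : EReal) < bGP _ e ξ η →
      ((c - E : ℝ) : EReal) ≤ bGP _ f (F ξ) (F η) := by
    intro ξ η c hc
    obtain ⟨u, v, rfl, rfl, n0, h⟩ := lt_bGP _ _ _ _ _ hc
    refine le_bGP _ f ⟨u.1, fun n => hS (u.2.1 n), equivAtInf_base e f _ _ u.2.2⟩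
      ⟨v.1, fun n => hS (v.2.1 n), equivAtInf_base e f _ _ v.2.2⟩ _ ⟨n0, fun n hn m hm => ?_⟩
    have h1 := h n hn m hm
    have h2 := gprod_base e f (u.1 n) (v.1 m)
    simp only
    linarith
  have cmp2 : ∀ ξ η, ∀ c : ℝ, (c : EReal) < bGP _ f (F ξ) (F η) →
      ((c - E : ℝ) : EReal) ≤ bGP _ e ξ η := by
    intro ξ η c hc
    obtain ⟨u', v', hu, hv, n0, h⟩ := lt_bGP _ _ _ _ _ hc
    induction ξ using Quot.ind with | _ u
    induction η using Quot.ind with | _ v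
    have hu := mk_exact hX N' f _ _ hu
    have hv := mk_exact hX N' f _ _ hv
    rw [equivAtInf_iff] at hu hv
    obtain ⟨n1, hu⟩ := hu c
    obtain ⟨n2, hv⟩ := hv c
    refine le_bGP _ e u v _ ⟨max n0 (max n1 n2), fun n hn m hm => ?_⟩
    set k := max n0 (max n1 n2)
    have k0 : n0 ≤ k := le_max_left _ _
    have k1 : n1 ≤ k := (le_max_left _ _).trans (le_max_right _ _)
    have k2 : n2 ≤ k := (le_max_right _ _).trans (le_max_right _ _)
    have h1 := hu k k1 n (k1.trans hn)
    have h2 := hv k k2 m (k2.trans hm)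
    have h3 := h k k0 k k0
    rw [gprod_comm] at h1
    have h4 := hyp hX N' f _ _ _ (hS (u.2.1 n)) (u'.2.1 k) (v'.2.1 k) c h1 h3
    have h5 := hyp hX N' f _ _ _ (hS (u.2.1 n)) (v'.2.1 k) (hS (v.2.1 m)) (c - 4 * N' 3 0) h4
      (le_trans (by linarith) h2)
    have h6 := gprod_base f e (u.1 n) (v.1 m)
    rw [dist_comm, hef] at h6
    linarith
  refine ⟨hinj, _, homeo_pow (k₂' / k₁' * Real.exp (2 * ε' * E)) (k₂ / k₁) (ε' / ε)
    (by positivity) (by positivity) (by positivity), ?_⟩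
  intro x y z hxy hxz _
  have pos : ∀ ξ η, ξ ≠ η → 0 < d ξ η := fun ξ η h =>
    lt_of_le_of_ne (hd0 _ _) (fun h' => h ((hdz _ _).1 h'.symm))
  have pos' : ∀ ξ η, ξ ≠ η → 0 < d' (F ξ) (F η) := fun ξ η h =>
    lt_of_le_of_ne (hd0' _ _) (fun h' => h (hinj ((hdz' _ _).1 h'.symm)))
  have t1 := visual_ne_top _ e d k₂ ε x y (hk x y).2 (pos _ _ hxy)
  have t2 := visual_ne_top _ e d k₂ ε x z (hk x z).2 (pos _ _ hxz)
  have t3 := visual_ne_top _ f d' k₂' ε' (F x) (F y) (hk' _ _).2 (pos' _ _ hxy)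
  have t4 := visual_ne_top _ f d' k₂' ε' (F x) (F z) (hk' _ _).2 (pos' _ _ hxz)
  have a1 := hk x y
  have a2 := hk x z
  have a3 := hk' (F x) (F y)
  have a4 := hk' (F x) (F z)
  rw [visGauge, if_neg t1] at a1
  rw [visGauge, if_neg t2] at a2
  rw [visGauge, if_neg t3] at a3
  rw [visGauge, if_neg t4] at a4
  exact qs_estimate ε ε' k₁ k₂ k₁' k₂' E _ _ _ _ _ _ _ _ hε hε' hk₁ hk₂ hk₁' hk₂'
    (ereal_compare _ _ E (bGP_nonneg _ _ _ _) (bGP_nonneg _ _ _ _) t1 t3 (cmp1 x y))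
    (ereal_compare _ _ E (bGP_nonneg _ _ _ _) (bGP_nonneg _ _ _ _) t4 t2 (cmp2 x z))
    a1.1 a2.2 (pos _ _ hxz) a3.2 a4.1
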